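/- For all reals 0 < μ < 1 and 0 < ν < 1 there exists a constant C(μ,ν) > 0 (depending only on μ and ν) such that for all integers k, ℓ ≥ 1 and every j ∈ {0, 1, …, k+ℓ}: | P(S_{k,ℓ} = j) − (2π b_{k,ℓ})^{−1/2} · exp( −x_{j,k,ℓ}² / 2 ) | ≤ C(μ,ν) / b_{k,ℓ}, where S_{k,ℓ} := ξ_k^{(ν)} + η_ℓ^{(μ)} is the sum of two independent binomial random variables with parameters (k,ν) and (ℓ,μ), m_{k,ℓ} := E S_{k,ℓ} = νk + μℓ, b_{k,ℓ} := Var S_{k,ℓ} = ν(1−ν)k + μ(1−μ)ℓ, and x_{j,k,ℓ} := (j − m_{k,ℓ})/√(b_{k,ℓ}). -/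

import Mathlib

open MeasureTheory ProbabilityTheory Filter

/-- The probability that a binomial random variable with parameters `(n, p)` equals `k`. -/
noncomputable def binomPMF (n : ℕ) (p : ℝ) (k : ℕ) : ℝ :=
  (n.choose k : ℝ) * p ^ k * (1 - p) ^ (n - k)

/-- The probability that the sum of two independent binomial random variables, with
parameters `(n, p)` and `(m, q)` respectively, equals `j`. -/
noncomputable def probSumEq (n : ℕ) (p : ℝ) (m : ℕ) (q : ℝ) (j : ℕ) : ℝ :=
  ∑ i ∈ Finset.range (j + 1), binomPMF n p i * binomPMF m q (j - i)

section

open Complex Polynomial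

theorem norm_pow_sub_pow_le {a b : ℂ} {r δ : ℝ} (hr : 0 < r) (ha : ‖a‖ ≤ r) (hb : ‖b‖ ≤ r)
    (hab : ‖a - b‖ ≤ r * δ) (n : ℕ) : ‖a ^ n - b ^ n‖ ≤ n * r ^ n * δ := by
  induction n with
  | zero => simp
  | succ n ih =>
    have hsplit : a ^ (n + 1) - b ^ (n + 1) = (a ^ n - b ^ n) * a + b ^ n * (a - b) := by ring
    have hbn : ‖b ^ n‖ ≤ r ^ n := by
      rw [norm_pow]; exact pow_le_pow_left₀ (norm_nonneg _) hb n
    calc ‖a ^ (n + 1) - b ^ (n + 1)‖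
        ≤ ‖a ^ n - b ^ n‖ * ‖a‖ + ‖b ^ n‖ * ‖a - b‖ := by
          rw [hsplit, ← norm_mul, ← norm_mul]; exact norm_add_le _ _
      _ ≤ (n * r ^ n * δ) * r + r ^ n * (r * δ) := by
          gcongr
          exact (norm_nonneg _).trans ih
      _ = (n + 1 : ℕ) * r ^ (n + 1) * δ := by push_cast; ring

theorem norm_pow_mul_pow_sub_le {a b u v : ℂ} {r s δ : ℝ} (hr : 0 < r) (hs : 0 < s)
    (ha : ‖a‖ ≤ r) (hb : ‖b‖ ≤ r) (hu : ‖u‖ ≤ s) (hv : ‖v‖ ≤ s)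
    (hab : ‖a - b‖ ≤ r * δ) (huv : ‖u - v‖ ≤ s * δ) (k l : ℕ) :
    ‖a ^ k * u ^ l - b ^ k * v ^ l‖ ≤ (k + l) * δ * (r ^ k * s ^ l) := by
  have hsplit : a ^ k * u ^ l - b ^ k * v ^ l
      = (a ^ k - b ^ k) * u ^ l + b ^ k * (u ^ l - v ^ l) := by ring
  have hbk : ‖b ^ k‖ ≤ r ^ k := by
    rw [norm_pow]; exact pow_le_pow_left₀ (norm_nonneg _) hb k
  have hul : ‖u ^ l‖ ≤ s ^ l := by
    rw [norm_pow]; exact pow_le_pow_left₀ (norm_nonneg _) hu l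
  have h1 := norm_pow_sub_pow_le hr ha hb hab k
  have h2 := norm_pow_sub_pow_le hs hu hv huv l
  calc ‖a ^ k * u ^ l - b ^ k * v ^ l‖
      ≤ ‖a ^ k - b ^ k‖ * ‖u ^ l‖ + ‖b ^ k‖ * ‖u ^ l - v ^ l‖ := by
        rw [hsplit, ← norm_mul, ← norm_mul]; exact norm_add_le _ _
    _ ≤ (k * r ^ k * δ) * s ^ l + r ^ k * (l * s ^ l * δ) := by
        gcongr
        exact (norm_nonneg _).trans h1
    _ = (k + l) * δ * (r ^ k * s ^ l) := by ring

/-- The characteristic function of a centred Bernoulli variable. -/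
noncomputable def centredBernoulliChar (p t : ℝ) : ℂ :=
  (1 - p + p * cexp (t * I)) * cexp (-(p * t * I))

theorem norm_centredBernoulliChar_le {p t : ℝ} (hp0 : 0 < p) (hp1 : p < 1) (ht : |t| ≤ Real.pi) :
    ‖centredBernoulliChar p t‖ ≤ Real.exp (-(2 / Real.pi ^ 2 * (p * (1 - p)) * t ^ 2)) := by
  have hphase : ‖cexp (-(p * t * I))‖ = 1 := by
    have := norm_exp_ofReal_mul_I (-(p * t))
    push_cast at this; rwa [neg_mul] at this
  rw [centredBernoulliChar, norm_mul, hphase, mul_one]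
  have hsq : ‖(1 - p + p * cexp (t * I) : ℂ)‖ ^ 2 = 1 - 2 * (p * (1 - p)) * (1 - Real.cos t) := by
    rw [← normSq_eq_norm_sq, normSq_apply]
    simp [exp_ofReal_mul_I_re, exp_ofReal_mul_I_im]
    linear_combination p ^ 2 * Real.sin_sq_add_cos_sq t
  refine le_of_sq_le_sq ?_ (Real.exp_pos _).le
  rw [hsq, ← Real.exp_nat_mul]
  have hcos := Real.cos_le_one_sub_mul_cos_sq ht
  have hexp := Real.add_one_le_exp ((2 : ℕ) * (-(2 / Real.pi ^ 2 * (p * (1 - p)) * t ^ 2)))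
  refine le_trans ?_ hexp
  have hσ : 0 < p * (1 - p) := mul_pos hp0 (by linarith)
  push_cast
  nlinarith

theorem norm_centredBernoulliChar_sub_exp_le {p t : ℝ} (hp0 : 0 < p) (hp1 : p < 1)
    (ht : |t| ≤ Real.pi) :
    ‖centredBernoulliChar p t - Real.exp (-(p * (1 - p) * t ^ 2 / 2))‖
      ≤ 2 * Real.exp 4 * |t| ^ 3 := by
  have hπ : Real.pi ≤ 4 := Real.pi_le_four
  have htaylor : ∀ q : ℝ, |q| ≤ 1 →
      ‖cexp (q * t * I) - (1 + q * t * I - (q * t) ^ 2 / 2)‖ ≤ Real.exp 4 * |t| ^ 3 := by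
    intro q hq
    have h := norm_exp_sub_sum_le_norm_mul_exp (q * t * I) 3
    have hn : ‖(q * t * I : ℂ)‖ = |q| * |t| := by simp
    have hqt : |q| * |t| ≤ |t| := mul_le_of_le_one_left (abs_nonneg _) hq
    have hs : ∑ m ∈ Finset.range 3, (q * t * I : ℂ) ^ m / m.factorial
        = 1 + q * t * I - (q * t) ^ 2 / 2 := by
      simp [Finset.sum_range_succ, mul_pow, Nat.factorial]; ring
    rw [hs, hn] at h
    refine h.trans ?_
    rw [mul_comm]
    gcongr
    linarith
  have hσ0 : 0 < p * (1 - p) := mul_pos hp0 (by linarith)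
  have hσ1 : p * (1 - p) ≤ 1 / 4 := by nlinarith [sq_nonneg (p - 1 / 2)]
  have hgauss : ‖((1 - p * (1 - p) * t ^ 2 / 2 : ℝ) : ℂ) - Real.exp (-(p * (1 - p) * t ^ 2 / 2))‖
      ≤ Real.exp 4 * |t| ^ 3 := by
    set u := p * (1 - p) * t ^ 2 / 2 with hu
    have hu0 : 0 ≤ u := by positivity
    have hut : u ≤ |t| ^ 2 / 8 := by rw [hu, sq_abs]; nlinarith [sq_nonneg t]
    have h := norm_exp_sub_sum_le_norm_mul_exp ((-u : ℝ) : ℂ) 2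
    have hs : ∑ m ∈ Finset.range 2, ((-u : ℝ) : ℂ) ^ m / m.factorial = ((1 - u : ℝ) : ℂ) := by
      simp [Finset.sum_range_succ]; ring
    rw [hs, norm_real, Real.norm_eq_abs, abs_neg, abs_of_nonneg hu0] at h
    rw [norm_sub_rev, ofReal_exp]
    have ht0 := abs_nonneg t
    have ht4 : |t| ≤ 4 := ht.trans hπ
    refine h.trans ?_
    rw [mul_comm]
    have : u ≤ 4 := by nlinarith
    gcongr
    calc u ^ 2 ≤ (|t| ^ 2 / 8) ^ 2 := by gcongr
      _ = |t| ^ 3 * (|t| / 64) := by ring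
      _ ≤ |t| ^ 3 * 1 := by gcongr; linarith
      _ = _ := mul_one _
  have h1 := htaylor (-p) (by rw [abs_neg, abs_of_pos hp0]; exact hp1.le)
  have h2 := htaylor (1 - p) (by rw [abs_of_pos (by linarith)]; linarith)
  have hsplit : centredBernoulliChar p t - Real.exp (-(p * (1 - p) * t ^ 2 / 2))
      = ((1 - p : ℝ) : ℂ) * (cexp ((-p : ℝ) * t * I)
          - (1 + (-p : ℝ) * t * I - ((-p : ℝ) * t) ^ 2 / 2))
        + (p : ℂ) * (cexp ((1 - p : ℝ) * t * I)
          - (1 + (1 - p : ℝ) * t * I - ((1 - p : ℝ) * t) ^ 2 / 2))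
        + (((1 - p * (1 - p) * t ^ 2 / 2 : ℝ) : ℂ) - Real.exp (-(p * (1 - p) * t ^ 2 / 2))) := by
    have he : cexp ((1 - p : ℝ) * t * I) = cexp (t * I) * cexp (-(p * t * I)) := by
      rw [← Complex.exp_add]; congr 1; push_cast; ring
    have he' : cexp ((-p : ℝ) * t * I) = cexp (-(p * t * I)) := by
      congr 1; push_cast; ring
    rw [he, he', centredBernoulliChar]
    push_cast
    ring
  rw [hsplit]
  refine (norm_add₃_le).trans ?_
  rw [norm_mul, norm_mul, norm_real, norm_real, Real.norm_eq_abs, Real.norm_eq_abs,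
    abs_of_pos hp0, abs_of_pos (by linarith : 0 < 1 - p)]
  have h1' := mul_le_mul_of_nonneg_left h1 (by linarith : 0 ≤ 1 - p)
  have h2' := mul_le_mul_of_nonneg_left h2 hp0.le
  linarith

theorem integral_exp_int_mul_I (n : ℤ) :
    ∫ t in (-Real.pi)..Real.pi, cexp (n * t * I) = if n = 0 then (2 * Real.pi : ℂ) else 0 := by
  split_ifs with h
  · simp [h]; ring
  · have hc : (n * I : ℂ) ≠ 0 := by simp [h]
    have := integral_exp_mul_complex (a := -Real.pi) (b := Real.pi) hc
    rw [show (fun t : ℝ => cexp (n * t * I)) = fun t : ℝ => cexp (n * I * t) from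
      funext fun t => by ring_nf, this]
    rw [div_eq_zero_iff]; left
    rw [sub_eq_zero, Complex.exp_eq_exp_iff_exists_int]
    exact ⟨n, by push_cast; ring⟩

theorem integral_eval_exp_mul_I (Q : ℂ[X]) (j : ℕ) :
    ∫ t in (-Real.pi)..Real.pi, Q.eval (cexp (t * I)) * cexp (-(j * t * I))
      = 2 * Real.pi * Q.coeff j := by
  induction Q using Polynomial.induction_on' with
  | add p q hp hq =>
    simp only [eval_add, add_mul, coeff_add, mul_add]
    rw [intervalIntegral.integral_add, hp, hq]
    all_goals exact (by fun_prop : Continuous _).intervalIntegrable _ _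
  | monomial n a =>
    have h := integral_exp_int_mul_I ((n : ℤ) - j)
    have hfun : (fun t : ℝ => (monomial n a).eval (cexp (t * I)) * cexp (-(j * t * I)))
        = fun t : ℝ => a * cexp (((n : ℤ) - j : ℤ) * t * I) := by
      funext t
      rw [eval_monomial, ← Complex.exp_nat_mul, mul_assoc, ← Complex.exp_add]
      congr 2; push_cast; ring
    rw [hfun, intervalIntegral.integral_const_mul, h, coeff_monomial]
    by_cases hn : n = j
    · simp [hn]; ring
    · have : (n : ℤ) - j ≠ 0 := by omega
      simp [hn, this]

theorem coeff_bernoulli_pow (n : ℕ) (p : ℝ) (i : ℕ) :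
    ((C (1 - p : ℂ) + C (p : ℂ) * X) ^ n).coeff i = (binomPMF n p i : ℂ) := by
  rw [add_comm, add_pow, finsetSum_coeff]
  have hterm : ∀ m ∈ Finset.range (n + 1),
      ((C (p : ℂ) * X) ^ m * C (1 - p : ℂ) ^ (n - m) * (n.choose m : ℂ[X])).coeff i
        = if i = m then (binomPMF n p i : ℂ) else 0 := by
    intro m _
    rw [← C_eq_natCast, ← C_pow, coeff_mul_C, coeff_mul_C, mul_pow, ← C_pow, coeff_C_mul,
      coeff_X_pow]
    split_ifs with h
    · subst h; rw [binomPMF]; push_cast; ring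
    · simp
  rw [Finset.sum_congr rfl hterm, Finset.sum_ite_eq]
  split_ifs with h
  · rfl
  · rw [binomPMF, Nat.choose_eq_zero_of_lt (by simpa using h)]; simp

theorem coeff_bernoulli_pow_mul_pow (k l : ℕ) (p q : ℝ) (j : ℕ) :
    ((C (1 - p : ℂ) + C (p : ℂ) * X) ^ k * (C (1 - q : ℂ) + C (q : ℂ) * X) ^ l).coeff j
      = (probSumEq k p l q j : ℂ) := by
  rw [coeff_mul, Finset.Nat.sum_antidiagonal_eq_sum_range_succ_mk, probSumEq]
  push_cast
  exact Finset.sum_congr rfl fun i _ => by rw [coeff_bernoulli_pow, coeff_bernoulli_pow]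

theorem integral_centredBernoulliChar_pow_mul_pow (k l : ℕ) (p q : ℝ) (j : ℕ) :
    ∫ t in (-Real.pi)..Real.pi, centredBernoulliChar p t ^ k * centredBernoulliChar q t ^ l
        * cexp (I * (-(j - (p * k + q * l)) : ℝ) * t)
      = 2 * Real.pi * probSumEq k p l q j := by
  rw [← coeff_bernoulli_pow_mul_pow, ← integral_eval_exp_mul_I]
  congr 1
  funext t
  simp only [eval_mul, eval_pow, eval_add, eval_C, eval_X, centredBernoulliChar, mul_pow,
    ← Complex.exp_nat_mul]
  have he : cexp (-(j * t * I)) = cexp (k * -(p * t * I)) * cexp (l * -(q * t * I))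
      * cexp (I * (-(j - (p * k + q * l)) : ℝ) * t) := by
    rw [← Complex.exp_add, ← Complex.exp_add]; congr 1; push_cast; ring
  rw [he]
  ring

theorem integral_exp_neg_mul_cexp {b : ℝ} (hb : 0 < b) (y : ℝ) :
    ∫ t : ℝ, (Real.exp (-(b * t ^ 2 / 2)) : ℂ) * cexp (I * (-y : ℝ) * t)
      = (2 * Real.pi * ((Real.sqrt (2 * Real.pi * b))⁻¹
          * Real.exp (-(y / Real.sqrt b) ^ 2 / 2)) : ℝ) := by
  have h := fourierIntegral_gaussian (b := ((b / 2 : ℝ) : ℂ)) (by simpa using hb) ((-y : ℝ) : ℂ)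
  have hfun : (fun t : ℝ => (Real.exp (-(b * t ^ 2 / 2)) : ℂ) * cexp (I * (-y : ℝ) * t))
      = fun t : ℝ => cexp (I * (-y : ℝ) * t) * cexp (-((b / 2 : ℝ) : ℂ) * t ^ 2) := by
    funext t
    rw [mul_comm, ofReal_exp]
    congr 2; push_cast; ring
  rw [hfun, h]
  have hpos : 0 ≤ Real.pi / (b / 2) := by positivity
  have hroot : ((Real.pi : ℂ) / ((b / 2 : ℝ) : ℂ)) ^ (1 / 2 : ℂ)
      = (Real.sqrt (Real.pi / (b / 2)) : ℂ) := by
    rw [Real.sqrt_eq_rpow, ofReal_cpow hpos]; push_cast; rfl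
  have hsqrt : Real.sqrt (Real.pi / (b / 2)) = 2 * Real.pi * (Real.sqrt (2 * Real.pi * b))⁻¹ := by
    rw [Real.sqrt_eq_iff_mul_self_eq hpos (by positivity)]
    have := Real.mul_self_sqrt (by positivity : 0 ≤ 2 * Real.pi * b)
    rw [mul_mul_mul_comm, ← mul_inv, this]
    field_simp
  have hexp : cexp (-((-y : ℝ) : ℂ) ^ 2 / (4 * ((b / 2 : ℝ) : ℂ)))
      = (Real.exp (-(y / Real.sqrt b) ^ 2 / 2) : ℂ) := by
    rw [ofReal_exp, div_pow, Real.sq_sqrt hb.le]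
    congr 1
    have : (b : ℂ) ≠ 0 := by exact_mod_cast hb.ne'
    push_cast
    field_simp
    ring
  rw [hroot, hexp, hsqrt]
  push_cast
  ring

theorem integral_abs_mul_exp_neg_mul_sq {a : ℝ} (ha : 0 < a) :
    ∫ t : ℝ, |t| * Real.exp (-a * t ^ 2) = a⁻¹ := by
  have h := integral_comp_abs (f := fun t : ℝ => t * Real.exp (-a * t ^ 2))
  have h' := integral_rpow_mul_exp_neg_mul_rpow (p := 2) (q := 1) two_pos (by norm_num) ha
  norm_num [Real.rpow_neg_one] at h'
  simp only [sq_abs] at h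
  simp only [neg_mul] at h ⊢
  rw [h, h']
  ring

theorem integral_abs_pow_three_mul_exp_neg_mul_sq {a : ℝ} (ha : 0 < a) :
    ∫ t : ℝ, |t| ^ 3 * Real.exp (-a * t ^ 2) = (a ^ 2)⁻¹ := by
  have h := integral_comp_abs (f := fun t : ℝ => t ^ 3 * Real.exp (-a * t ^ 2))
  have h' := integral_rpow_mul_exp_neg_mul_rpow (p := 2) (q := 3) two_pos (by norm_num) ha
  have hrpow : a ^ (-2 : ℝ) = (a ^ 2)⁻¹ := by
    rw [Real.rpow_neg ha.le]; norm_cast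
  norm_num [hrpow] at h'
  simp only [sq_abs] at h
  simp only [neg_mul] at h ⊢
  rw [h]
  norm_cast at h' ⊢
  rw [h']
  ring

theorem integrable_abs_pow_mul_exp_neg_mul_sq {a : ℝ} (ha : 0 < a) (n : ℕ) :
    Integrable fun t : ℝ => |t| ^ n * Real.exp (-a * t ^ 2) := by
  have h := (integrable_rpow_mul_exp_neg_mul_sq ha (s := n)
    (by linarith [n.cast_nonneg (α := ℝ)])).norm
  refine h.congr (Filter.Eventually.of_forall fun t => ?_)
  simp [abs_of_pos (Real.exp_pos _)]

/-- The difference of the centred characteristic function (cut off to one period) and its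
Gaussian approximation. -/
noncomputable def charDefect (k l : ℕ) (p q t : ℝ) : ℂ :=
  (Set.Ioc (-Real.pi) Real.pi).indicator
      (fun t => centredBernoulliChar p t ^ k * centredBernoulliChar q t ^ l) t
    - Real.exp (-((p * (1 - p) * k + q * (1 - q) * l) * t ^ 2 / 2))

theorem norm_centredBernoulliChar_sub_exp_le_mul {p t : ℝ} (hp0 : 0 < p) (hp1 : p < 1)
    (ht : |t| ≤ Real.pi) :
    ‖centredBernoulliChar p t - Real.exp (-(p * (1 - p) * t ^ 2 / 2))‖
      ≤ Real.exp (-(2 / Real.pi ^ 2 * (p * (1 - p)) * t ^ 2)) * (2 * Real.exp 8 * |t| ^ 3) := by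
  refine (norm_centredBernoulliChar_sub_exp_le hp0 hp1 ht).trans ?_
  have hσ0 : 0 < p * (1 - p) := mul_pos hp0 (by linarith)
  have hσ1 : p * (1 - p) ≤ 1 / 4 := by nlinarith [sq_nonneg (p - 1 / 2)]
  have hct : 2 / Real.pi ^ 2 * t ^ 2 ≤ 2 := by
    have : t ^ 2 ≤ Real.pi ^ 2 := sq_le_sq' (abs_le.mp ht).1 (abs_le.mp ht).2
    rw [div_mul_eq_mul_div, div_le_iff₀ (by positivity)]
    linarith
  have hct0 : 0 ≤ 2 / Real.pi ^ 2 * t ^ 2 := by positivity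
  have he : Real.exp 4 ≤ Real.exp (-(2 / Real.pi ^ 2 * (p * (1 - p)) * t ^ 2)) * Real.exp 8 := by
    rw [← Real.exp_add]
    apply Real.exp_le_exp.mpr
    nlinarith
  have ht3 : 0 ≤ |t| ^ 3 := by positivity
  nlinarith [mul_le_mul_of_nonneg_right he ht3]

theorem two_div_pi_sq_le_half : 2 / Real.pi ^ 2 ≤ 1 / 2 := by
  rw [div_le_div_iff₀ (by positivity) two_pos]
  nlinarith [Real.pi_gt_three]

theorem norm_charDefect_le {p q : ℝ} (hp0 : 0 < p) (hp1 : p < 1) (hq0 : 0 < q) (hq1 : q < 1)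
    (k l : ℕ) (t : ℝ) :
    ‖charDefect k l p q t‖ ≤ (k + l) * (2 * Real.exp 8) *
        (|t| ^ 3 * Real.exp (-(2 / Real.pi ^ 2 * (p * (1 - p) * k + q * (1 - q) * l)) * t ^ 2))
      + |t| ^ 1 * Real.exp (-(2 / Real.pi ^ 2 * (p * (1 - p) * k + q * (1 - q) * l)) * t ^ 2) := by
  have hσp : 0 < p * (1 - p) := mul_pos hp0 (by linarith)
  have hσq : 0 < q * (1 - q) := mul_pos hq0 (by linarith)
  have hc := two_div_pi_sq_le_half
  have hgauss : ∀ σ : ℝ, 0 ≤ σ →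
      Real.exp (-(σ * t ^ 2 / 2)) ≤ Real.exp (-(2 / Real.pi ^ 2 * σ * t ^ 2)) := by
    intro σ hσ
    apply Real.exp_le_exp.mpr
    nlinarith [mul_le_mul_of_nonneg_right hc (mul_nonneg hσ (sq_nonneg t))]
  by_cases ht : t ∈ Set.Ioc (-Real.pi) Real.pi
  · have ht' : |t| ≤ Real.pi := abs_le.mpr ⟨ht.1.le, ht.2⟩
    rw [charDefect, Set.indicator_of_mem ht]
    have hpow : (Real.exp (-((p * (1 - p) * k + q * (1 - q) * l) * t ^ 2 / 2)) : ℂ)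
        = (Real.exp (-(p * (1 - p) * t ^ 2 / 2)) : ℂ) ^ k
          * (Real.exp (-(q * (1 - q) * t ^ 2 / 2)) : ℂ) ^ l := by
      norm_cast
      rw [← Real.exp_nat_mul, ← Real.exp_nat_mul, ← Real.exp_add]
      congr 1; ring
    have hpow' : Real.exp (-(2 / Real.pi ^ 2 * (p * (1 - p) * k + q * (1 - q) * l)) * t ^ 2)
        = Real.exp (-(2 / Real.pi ^ 2 * (p * (1 - p)) * t ^ 2)) ^ k
          * Real.exp (-(2 / Real.pi ^ 2 * (q * (1 - q)) * t ^ 2)) ^ l := by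
      rw [← Real.exp_nat_mul, ← Real.exp_nat_mul, ← Real.exp_add]
      congr 1; ring
    have hnorm : ∀ x : ℝ, ‖(Real.exp x : ℂ)‖ = Real.exp x := fun x => by
      rw [norm_real, Real.norm_eq_abs, abs_of_pos (Real.exp_pos x)]
    have h := norm_pow_mul_pow_sub_le (Real.exp_pos _) (Real.exp_pos _)
      (norm_centredBernoulliChar_le hp0 hp1 ht') ((hnorm _).le.trans (hgauss _ hσp.le))
      (norm_centredBernoulliChar_le hq0 hq1 ht') ((hnorm _).le.trans (hgauss _ hσq.le))
      (norm_centredBernoulliChar_sub_exp_le_mul hp0 hp1 ht')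
      (norm_centredBernoulliChar_sub_exp_le_mul hq0 hq1 ht') k l
    rw [hpow, hpow']
    refine h.trans (le_trans (le_of_eq ?_) (le_add_of_nonneg_right (by positivity)))
    ring
  · have ht1 : 1 ≤ |t| := by
      by_contra! hlt
      have := abs_lt.mp hlt
      exact ht ⟨by linarith [Real.pi_gt_three], by linarith [Real.pi_gt_three]⟩
    rw [charDefect, Set.indicator_of_notMem ht, zero_sub, norm_neg, norm_real, Real.norm_eq_abs,
      abs_of_pos (Real.exp_pos _)]
    refine le_trans ?_ (le_add_of_nonneg_left (by positivity))
    rw [pow_one, neg_mul]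
    exact (hgauss _ (by positivity)).trans (le_mul_of_one_le_left (Real.exp_pos _).le ht1)

theorem integral_charDefect_mul_cexp {k l : ℕ} {p q : ℝ}
    (hb : 0 < p * (1 - p) * k + q * (1 - q) * l) (j : ℕ) :
    ∫ t : ℝ, charDefect k l p q t * cexp (I * (-(j - (p * k + q * l)) : ℝ) * t)
      = (2 * Real.pi * (probSumEq k p l q j
        - (Real.sqrt (2 * Real.pi * (p * (1 - p) * k + q * (1 - q) * l)))⁻¹
          * Real.exp (-((j - (p * k + q * l)) / Real.sqrt (p * (1 - p) * k + q * (1 - q) * l)) ^ 2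
            / 2)) : ℝ) := by
  set b := p * (1 - p) * k + q * (1 - q) * l
  set y : ℝ := j - (p * k + q * l)
  have hcont : Continuous fun t : ℝ => centredBernoulliChar p t ^ k * centredBernoulliChar q t ^ l
      * cexp (I * (-y : ℝ) * t) := by
    unfold centredBernoulliChar; fun_prop
  have hsplit : (fun t : ℝ => charDefect k l p q t * cexp (I * (-y : ℝ) * t))
      = fun t : ℝ => (Set.Ioc (-Real.pi) Real.pi).indicator
          (fun t : ℝ => centredBernoulliChar p t ^ k * centredBernoulliChar q t ^ l
            * cexp (I * (-y : ℝ) * t)) t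
        - (Real.exp (-(b * t ^ 2 / 2)) : ℂ) * cexp (I * (-y : ℝ) * t) := by
    funext t
    rw [charDefect, sub_mul]
    congr 1
    simp only [Set.indicator_apply]
    split_ifs <;> simp
  have hint : Integrable fun t : ℝ =>
      (Real.exp (-(b * t ^ 2 / 2)) : ℂ) * cexp (I * (-y : ℝ) * t) := by
    refine (integrable_exp_neg_mul_sq (half_pos hb)).mono'
      (by fun_prop : Continuous _).aestronglyMeasurable (Filter.Eventually.of_forall fun t => ?_)
    have : ‖cexp (I * (-y : ℝ) * t)‖ = 1 := by
      have := norm_exp_I_mul_ofReal (-y * t)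
      rwa [ofReal_mul, ← mul_assoc] at this
    rw [norm_mul, this, mul_one, norm_real, Real.norm_eq_abs, abs_of_pos (Real.exp_pos _)]
    apply le_of_eq; congr 1; ring
  have hle : -Real.pi ≤ Real.pi := by linarith [Real.pi_pos]
  rw [hsplit, integral_sub _ hint, integral_indicator measurableSet_Ioc,
    ← intervalIntegral.integral_of_le hle, integral_centredBernoulliChar_pow_mul_pow,
    integral_exp_neg_mul_cexp hb]
  · push_cast; ring
  · rw [integrable_indicator_iff measurableSet_Ioc]
    exact (intervalIntegrable_iff_integrableOn_Ioc_of_le hle).mp (hcont.intervalIntegrable _ _)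

theorem abs_probSumEq_sub_gaussian_le {p q : ℝ} (hp0 : 0 < p) (hp1 : p < 1) (hq0 : 0 < q)
    (hq1 : q < 1) {k l : ℕ} (hb : 0 < p * (1 - p) * k + q * (1 - q) * l) (j : ℕ) :
    2 * Real.pi * |probSumEq k p l q j
        - (Real.sqrt (2 * Real.pi * (p * (1 - p) * k + q * (1 - q) * l)))⁻¹
          * Real.exp (-((j - (p * k + q * l)) / Real.sqrt (p * (1 - p) * k + q * (1 - q) * l)) ^ 2
            / 2)|
      ≤ (k + l) * (2 * Real.exp 8)
          * ((2 / Real.pi ^ 2 * (p * (1 - p) * k + q * (1 - q) * l)) ^ 2)⁻¹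
        + (2 / Real.pi ^ 2 * (p * (1 - p) * k + q * (1 - q) * l))⁻¹ := by
  have h := congrArg norm (integral_charDefect_mul_cexp hb j)
  rw [norm_real, Real.norm_eq_abs, abs_mul, abs_of_pos Real.two_pi_pos] at h
  rw [← h]
  have ha : 0 < 2 / Real.pi ^ 2 * (p * (1 - p) * k + q * (1 - q) * l) := by positivity
  have h3 := (integrable_abs_pow_mul_exp_neg_mul_sq ha 3).const_mul ((k + l) * (2 * Real.exp 8))
  have h1 := integrable_abs_pow_mul_exp_neg_mul_sq ha 1
  refine (norm_integral_le_of_norm_le (h3.add h1) (Filter.Eventually.of_forall fun t => ?_)).trans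
    (le_of_eq ?_)
  · have : ‖cexp (I * (-(j - (p * k + q * l)) : ℝ) * t)‖ = 1 := by
      have := norm_exp_I_mul_ofReal (-(j - (p * k + q * l)) * t)
      rwa [ofReal_mul, ← mul_assoc] at this
    rw [norm_mul, this, mul_one]
    exact norm_charDefect_le hp0 hp1 hq0 hq1 k l t
  · simp only [Pi.add_apply]
    rw [integral_add h3 h1, integral_const_mul, integral_abs_pow_three_mul_exp_neg_mul_sq ha]
    simp only [pow_one]
    rw [integral_abs_mul_exp_neg_mul_sq ha]

end

theorem local_clt_binomial_sum (μ ν : ℝ)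
    (hμ0 : 0 < μ) (hμ1 : μ < 1) (hν0 : 0 < ν) (hν1 : ν < 1) :
    ∃ C : ℝ, 0 < C ∧ ∀ k ℓ : ℕ, 1 ≤ k → 1 ≤ ℓ → ∀ j : ℕ, j ≤ k + ℓ →
      |probSumEq k ν ℓ μ j -
          (Real.sqrt (2 * Real.pi * (ν * (1 - ν) * k + μ * (1 - μ) * ℓ)))⁻¹ *
            Real.exp (-(((j : ℝ) - (ν * k + μ * ℓ)) /
              Real.sqrt (ν * (1 - ν) * k + μ * (1 - μ) * ℓ)) ^ 2 / 2)| ≤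
        C / (ν * (1 - ν) * k + μ * (1 - μ) * ℓ) := by
  have hσν : 0 < ν * (1 - ν) := mul_pos hν0 (by linarith)
  have hσμ : 0 < μ * (1 - μ) := mul_pos hμ0 (by linarith)
  set s := min (ν * (1 - ν)) (μ * (1 - μ))
  have hs0 : 0 < s := lt_min hσν hσμ
  set c := 2 / Real.pi ^ 2 with hc
  have hc0 : 0 < c := by positivity
  refine ⟨2 * Real.exp 8 / (s * c ^ 2) + 1 / c, by positivity, fun k ℓ hk _ j _ => ?_⟩
  have hk' : (0 : ℝ) < k := by exact_mod_cast hk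
  have hb : 0 < ν * (1 - ν) * k + μ * (1 - μ) * ℓ := by positivity
  have hmain := abs_probSumEq_sub_gaussian_le hν0 hν1 hμ0 hμ1 hb j
  have hN : (k + ℓ : ℝ) ≤ (ν * (1 - ν) * k + μ * (1 - μ) * ℓ) / s := by
    rw [le_div_iff₀ hs0]
    have h1 : s * k ≤ ν * (1 - ν) * k := by gcongr; exact min_le_left _ _
    have h2 : s * ℓ ≤ μ * (1 - μ) * ℓ := by gcongr; exact min_le_right _ _
    linarith
  rw [← hc] at hmain
  set b := ν * (1 - ν) * k + μ * (1 - μ) * ℓ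
  refine (le_mul_of_one_le_left (abs_nonneg _) (by linarith [Real.pi_gt_three])).trans
    (hmain.trans ?_)
  calc (k + ℓ : ℝ) * (2 * Real.exp 8) * ((c * b) ^ 2)⁻¹ + (c * b)⁻¹
      ≤ b / s * (2 * Real.exp 8) * ((c * b) ^ 2)⁻¹ + (c * b)⁻¹ := by gcongr
    _ = (2 * Real.exp 8 / (s * c ^ 2) + 1 / c) / b := by
      field_simp
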